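/- Let f ∈ 𝒦 have radius of convergence R > 0 and fulcrum F. If lim_{s↑ln R} F^{(k)}(s)/F″(s)^{k/2} = 0 for every integer k ≥ 3, then f is Gaussian, i.e. the normalized Khinchin family X̆_t converges in distribution to the standard normal N(0,1) as t ↑ R. -/

import Mathlib

open scoped BigOperators Topology
open Filter

namespace KhinchinPaper

/-- Sum of the power series with coefficients `a` at `t`. -/
noncomputable def fsum (a : ℕ → ℝ) (t : ℝ) : ℝ := ∑' n : ℕ, a n * t ^ n

/-- The class `𝒦`: non-constant power series with non-negative coefficients, `a 0 > 0`,
and radius of convergence `R > 0`. -/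
structure IsK (a : ℕ → ℝ) (R : ℝ) : Prop where
  pos₀ : 0 < a 0
  nonneg : ∀ n, 0 ≤ a n
  nonconst : ∃ n, 0 < n ∧ 0 < a n
  Rpos : 0 < R
  conv : ∀ t : ℝ, 0 ≤ t → t < R → Summable fun n : ℕ => a n * t ^ n
  radius : ∀ t : ℝ, R < t → ¬ Summable fun n : ℕ => a n * t ^ n

/-- Mean function `m_f(t) = t f'(t)/f(t)`. -/
noncomputable def mf (a : ℕ → ℝ) (t : ℝ) : ℝ :=
  (∑' n : ℕ, (n : ℝ) * a n * t ^ n) / fsum a t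

/-- Variance function `σ_f²(t)`. -/
noncomputable def sigma2 (a : ℕ → ℝ) (t : ℝ) : ℝ :=
  (∑' n : ℕ, (n : ℝ) ^ 2 * a n * t ^ n) / fsum a t - (mf a t) ^ 2

noncomputable def sigma (a : ℕ → ℝ) (t : ℝ) : ℝ := Real.sqrt (sigma2 a t)

/-- `k`-th moment of the normalized Khinchin family variable `X̆_t`. -/
noncomputable def normMoment (a : ℕ → ℝ) (t : ℝ) (k : ℕ) : ℝ :=
  ∑' n : ℕ, (a n * t ^ n / fsum a t) * (((n : ℝ) - mf a t) / sigma a t) ^ k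

/-- `k`-th central moment of `X_t`. -/
noncomputable def centralMoment (a : ℕ → ℝ) (t : ℝ) (k : ℕ) : ℝ :=
  ∑' n : ℕ, (a n * t ^ n / fsum a t) * ((n : ℝ) - mf a t) ^ k

/-- Characteristic function `E(e^{iθ X̆_t})` of the normalized variable. -/
noncomputable def charfun (a : ℕ → ℝ) (t θ : ℝ) : ℂ :=
  ∑' n : ℕ, ((a n * t ^ n / fsum a t : ℝ) : ℂ) *
    Complex.exp (Complex.I * (θ : ℂ) * ((((n : ℝ) - mf a t) / sigma a t : ℝ) : ℂ))

/-- `f` is Gaussian: `X̆_t → N(0,1)` in distribution as `t ↑ R`, expressed via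
pointwise convergence of characteristic functions (Lévy's continuity theorem). -/
def IsGaussian (a : ℕ → ℝ) (R : ℝ) : Prop :=
  ∀ θ : ℝ, Tendsto (fun t => charfun a t θ) (𝓝[<] R)
    (𝓝 (Complex.exp (-(θ : ℂ) ^ 2 / 2)))

/-- Gaussian for entire `f` (radius `R = ∞`, so `t → +∞`). -/
def IsGaussianEntire (a : ℕ → ℝ) : Prop :=
  ∀ θ : ℝ, Tendsto (fun t => charfun a t θ) atTop
    (𝓝 (Complex.exp (-(θ : ℂ) ^ 2 / 2)))

/-- The fulcrum `F(s) = log f(e^s)` restricted to the real axis. -/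
noncomputable def fulcrum (a : ℕ → ℝ) (s : ℝ) : ℝ := Real.log (fsum a (Real.exp s))

/-- The quotient `F^{(j)}(s) / F''(s)^{j/2}`. -/
noncomputable def Fq (a : ℕ → ℝ) (j : ℕ) (s : ℝ) : ℝ :=
  iteratedDeriv j (fulcrum a) s / (iteratedDeriv 2 (fulcrum a) s) ^ ((j : ℝ) / 2)

/-- Tuples `(m₂, …, m_n)` of non-negative integers with `2m₂ + ⋯ + n m_n = n`,
padded with `m₀ = m₁ = 0` and encoded as functions on `Fin (n+1)`. -/
def tuples (n : ℕ) : Finset (Fin (n + 1) → ℕ) :=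
  (Fintype.piFinset fun _ : Fin (n + 1) => Finset.range (n + 1)).filter
    fun m => m 0 = 0 ∧ m 1 = 0 ∧ ∑ j : Fin (n + 1), (j : ℕ) * m j = n

/-- Integer moments of a standard normal random variable `Z`. -/
noncomputable def gaussMoment (k : ℕ) : ℝ :=
  if Even k then (Nat.factorial k : ℝ) / ((Nat.factorial (k / 2) : ℝ) * 2 ^ (k / 2)) else 0

/-- The complex power series sum. -/
noncomputable def fsumC (a : ℕ → ℝ) (z : ℂ) : ℂ := ∑' n : ℕ, (a n : ℂ) * z ^ n

/-- The complex fulcrum `F(z) = log f(e^z)`. -/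
noncomputable def fulcrumC (a : ℕ → ℝ) (z : ℂ) : ℂ := Complex.log (fsumC a (Complex.exp z))

end KhinchinPaper

namespace KhinchinPaper

open MeasureTheory ProbabilityTheory

/-- Taylor remainder of `x ↦ exp (c x)` for a unit imaginary number `c`. -/
lemma norm_exp_sub_sum_le_of_re_eq_zero {c : ℂ} (hre : c.re = 0) (hc : ‖c‖ = 1) (n : ℕ) {x : ℝ}
    (hx : 0 ≤ x) :
    ‖Complex.exp (c * x) - ∑ k ∈ Finset.range n, (c * x) ^ k / (k.factorial : ℂ)‖
      ≤ x ^ n / n.factorial := by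
  induction n generalizing x with
  | zero => simp [Complex.norm_exp, hre]
  | succ n ih =>
    have hd : ∀ y : ℝ, HasDerivAt
        (fun y : ℝ => Complex.exp (c * y) -
          ∑ k ∈ Finset.range (n + 1), (c * y) ^ k / (k.factorial : ℂ))
        (c * (Complex.exp (c * y) - ∑ k ∈ Finset.range n, (c * y) ^ k / (k.factorial : ℂ))) y := by
      intro y
      have h0 : HasDerivAt (fun y : ℝ => c * (y : ℂ)) c y := by
        simpa using (Complex.ofRealCLM.hasDerivAt (x := y)).const_mul c
      have hs : HasDerivAt
          (fun y : ℝ => ∑ k ∈ Finset.range (n + 1), (c * (y : ℂ)) ^ k / (k.factorial : ℂ))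
          (∑ k ∈ Finset.range (n + 1),
            ((k : ℂ) * (c * y) ^ (k - 1) * c) / (k.factorial : ℂ)) y :=
        HasDerivAt.fun_sum fun k _ => (h0.fun_pow k).div_const _
      refine (h0.cexp.sub hs).congr_deriv ?_
      rw [Finset.sum_range_succ', mul_sub, Finset.mul_sum]
      simp only [Nat.cast_zero, zero_mul, zero_div, add_zero, Nat.add_sub_cancel]
      congr 1
      · ring
      · refine Finset.sum_congr rfl fun k _ => ?_
        rw [Nat.factorial_succ]
        have h1 : ((k.factorial : ℕ) : ℂ) ≠ 0 := by exact_mod_cast k.factorial_ne_zero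
        have h2 : ((k + 1 : ℕ) : ℂ) ≠ 0 := by exact_mod_cast k.succ_ne_zero
        push_cast at h2 ⊢
        field_simp
    refine image_norm_le_of_norm_deriv_right_le_deriv_boundary
      (a := 0) (b := x) (B := fun y => y ^ (n + 1) / (n + 1).factorial)
      (B' := fun y => y ^ n / n.factorial)
      (fun y _ => (hd y).continuousAt.continuousWithinAt) (fun y _ => (hd y).hasDerivWithinAt)
      ?_ ?_ ?_ ⟨hx, le_rfl⟩
    · simp [Finset.sum_range_succ']
    · intro y
      refine ((hasDerivAt_pow (n + 1) y).div_const _).congr_deriv ?_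
      rw [Nat.factorial_succ]
      have h1 : ((n.factorial : ℕ) : ℝ) ≠ 0 := by exact_mod_cast n.factorial_ne_zero
      push_cast
      field_simp
    · intro y hy
      rw [norm_mul, hc, one_mul]
      exact ih hy.1

/-- Taylor remainder of `x ↦ exp (i x)`. -/
lemma norm_exp_I_mul_sub_sum_le (n : ℕ) (x : ℝ) :
    ‖Complex.exp (Complex.I * x) -
      ∑ k ∈ Finset.range n, (Complex.I * x) ^ k / (k.factorial : ℂ)‖
      ≤ |x| ^ n / n.factorial := by
  rcases le_total 0 x with hx | hx
  · rw [abs_of_nonneg hx]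
    exact norm_exp_sub_sum_le_of_re_eq_zero (by simp) (by simp) n hx
  · rw [abs_of_nonpos hx]
    simpa using norm_exp_sub_sum_le_of_re_eq_zero (c := -Complex.I) (by simp) (by simp) n
      (neg_nonneg.2 hx)

lemma gaussMoment_two_mul_div (n : ℕ) :
    gaussMoment (2 * n) / (2 * n).factorial = (1 / 2) ^ n / n.factorial := by
  have h : ((2 * n).factorial : ℝ) ≠ 0 := by exact_mod_cast (2 * n).factorial_ne_zero
  simp only [gaussMoment, even_two_mul, if_true, Nat.mul_div_cancel_left n two_pos]
  field_simp
  rw [← mul_pow]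
  norm_num

lemma gaussMoment_two_mul_add_one (n : ℕ) : gaussMoment (2 * n + 1) = 0 := by
  simp [gaussMoment]

lemma gaussMoment_add_two (k : ℕ) : gaussMoment (k + 2) = (k + 1) * gaussMoment k := by
  rcases Nat.even_or_odd' k with ⟨n, rfl | rfl⟩
  · have h1 := gaussMoment_two_mul_div n
    have h2 := gaussMoment_two_mul_div (n + 1)
    rw [show 2 * (n + 1) = 2 * n + 2 by ring] at h2
    have h : ((2 * n).factorial : ℝ) ≠ 0 := by exact_mod_cast (2 * n).factorial_ne_zero
    have h' : ((2 * n + 2).factorial : ℝ) ≠ 0 := by exact_mod_cast (2 * n + 2).factorial_ne_zero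
    have h3 : (n.factorial : ℝ) ≠ 0 := by exact_mod_cast n.factorial_ne_zero
    rw [div_eq_iff h] at h1
    rw [div_eq_iff h'] at h2
    rw [h1, h2]
    simp only [Nat.factorial_succ]
    push_cast
    field_simp
    ring
  · rw [gaussMoment_two_mul_add_one, show 2 * n + 1 + 2 = 2 * (n + 1) + 1 by ring,
      gaussMoment_two_mul_add_one, mul_zero]

lemma tendsto_sum_gaussMoment (θ : ℝ) :
    Tendsto (fun n : ℕ => ∑ k ∈ Finset.range (2 * n),
      (Complex.I * θ) ^ k / (k.factorial : ℂ) * (gaussMoment k : ℂ)) atTop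
      (𝓝 (Complex.exp (-(θ : ℂ) ^ 2 / 2))) := by
  have h := (NormedSpace.expSeries_div_hasSum_exp (-(θ : ℂ) ^ 2 / 2)).tendsto_sum_nat
  rw [← Complex.exp_eq_exp_ℂ] at h
  refine h.congr fun n => ?_
  induction n with
  | zero => simp
  | succ n ih =>
    have h1 : ((gaussMoment (2 * n) : ℝ) : ℂ) / ((2 * n).factorial : ℂ)
        = (1 / 2) ^ n / (n.factorial : ℂ) := by
      simpa using congrArg (fun x : ℝ => (x : ℂ)) (gaussMoment_two_mul_div n)
    rw [Finset.sum_range_succ, ih, show 2 * (n + 1) = 2 * n + 1 + 1 by ring,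
      Finset.sum_range_succ, Finset.sum_range_succ, gaussMoment_two_mul_add_one,
      div_mul_eq_mul_div _ _ ((gaussMoment (2 * n) : ℝ) : ℂ), mul_div_assoc, h1, pow_mul,
      mul_pow Complex.I, Complex.I_sq, neg_div, ← mul_neg_one (_ / _)]
    simp only [Complex.ofReal_zero, mul_zero, add_zero, mul_pow, div_pow]
    ring

lemma tendsto_gaussMoment_remainder (θ : ℝ) :
    Tendsto (fun n : ℕ => |θ| ^ (2 * n) / (2 * n).factorial * gaussMoment (2 * n)) atTop (𝓝 0) := by
  refine (FloorSemiring.tendsto_pow_div_factorial_atTop (|θ| ^ 2 * (1 / 2))).congr fun n => ?_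
  rw [div_mul_eq_mul_div, mul_div_assoc, gaussMoment_two_mul_div, mul_pow, pow_mul, mul_div_assoc]

/-- Method of moments for the Gaussian limit, in terms of characteristic functions. -/
lemma tendsto_integral_exp_of_tendsto_moments {ι Ω : Type*} [MeasurableSpace Ω] {l : Filter ι}
    {P : ι → Measure Ω} {Y : ι → Ω → ℝ}
    (hint : ∀ᶠ i in l, ∀ k : ℕ, Integrable (fun ω => Y i ω ^ k) (P i))
    (hmom : ∀ k : ℕ, Tendsto (fun i => ∫ ω, Y i ω ^ k ∂(P i)) l (𝓝 (gaussMoment k))) (θ : ℝ) :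
    Tendsto (fun i => ∫ ω, Complex.exp (Complex.I * θ * (Y i ω : ℂ)) ∂(P i)) l
      (𝓝 (Complex.exp (-(θ : ℂ) ^ 2 / 2))) := by
  have hbound : ∀ n : ℕ, ∀ᶠ i in l,
      ‖∫ ω, Complex.exp (Complex.I * θ * (Y i ω : ℂ)) ∂(P i) -
        ∑ k ∈ Finset.range (2 * n), (Complex.I * θ) ^ k / (k.factorial : ℂ) *
          ((∫ ω, Y i ω ^ k ∂(P i) : ℝ) : ℂ)‖
      ≤ |θ| ^ (2 * n) / (2 * n).factorial * ∫ ω, Y i ω ^ (2 * n) ∂(P i) := by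
    intro n
    filter_upwards [hint] with i hi
    have hterm : ∀ k : ℕ, Integrable
        (fun ω => (Complex.I * θ) ^ k / (k.factorial : ℂ) * ((Y i ω ^ k : ℝ) : ℂ)) (P i) :=
      fun k => (hi k).ofReal.const_mul _
    have hexp : Integrable (fun ω => Complex.exp (Complex.I * θ * (Y i ω : ℂ))) (P i) := by
      have h0 : Integrable (fun _ : Ω => (1 : ℝ)) (P i) := by simpa using hi 0
      have h1 : AEStronglyMeasurable (fun ω => Y i ω) (P i) := by
        simpa using (hi 1).aestronglyMeasurable
      refine h0.mono' ?_ ?_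
      · exact (by fun_prop : Continuous fun y : ℝ =>
          Complex.exp (Complex.I * θ * (y : ℂ))).comp_aestronglyMeasurable h1
      · refine Eventually.of_forall fun ω => ?_
        simp [Complex.norm_exp]
    have hsum : ∑ k ∈ Finset.range (2 * n), (Complex.I * θ) ^ k / (k.factorial : ℂ) *
          ((∫ ω, Y i ω ^ k ∂(P i) : ℝ) : ℂ)
        = ∫ ω, ∑ k ∈ Finset.range (2 * n),
          (Complex.I * θ) ^ k / (k.factorial : ℂ) * ((Y i ω ^ k : ℝ) : ℂ) ∂(P i) := by
      rw [integral_finsetSum _ fun k _ => hterm k]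
      refine Finset.sum_congr rfl fun k _ => ?_
      rw [integral_const_mul, integral_complex_ofReal]
    rw [hsum, ← integral_sub hexp (integrable_finsetSum _ fun k _ => hterm k),
      ← integral_const_mul]
    refine norm_integral_le_of_norm_le ((hi (2 * n)).const_mul _)
      (Eventually.of_forall fun ω => ?_)
    refine (le_of_eq ?_).trans ((norm_exp_I_mul_sub_sum_le (2 * n) (θ * Y i ω)).trans
      (le_of_eq ?_))
    · push_cast
      congr 2
      · rw [mul_assoc]
      · refine Finset.sum_congr rfl fun k _ => ?_
        rw [← mul_assoc, mul_pow _ (Y i ω : ℂ)]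
        ring
    · rw [abs_mul, mul_pow, (even_two_mul n).pow_abs (Y i ω)]
      ring
  rw [Metric.tendsto_nhds]
  intro ε hε
  have e1 := Metric.tendsto_nhds.1 (tendsto_sum_gaussMoment θ) (ε / 2) (by positivity)
  have e2 := (tendsto_gaussMoment_remainder θ).eventually_lt_const (half_pos hε)
  obtain ⟨n, hn1, hn2⟩ := (e1.and e2).exists
  have hpart : Tendsto (fun i => ∑ k ∈ Finset.range (2 * n),
      (Complex.I * θ) ^ k / (k.factorial : ℂ) * ((∫ ω, Y i ω ^ k ∂(P i) : ℝ) : ℂ)) l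
      (𝓝 (∑ k ∈ Finset.range (2 * n),
        (Complex.I * θ) ^ k / (k.factorial : ℂ) * (gaussMoment k : ℂ))) :=
    tendsto_finsetSum _ fun k _ =>
      ((Complex.continuous_ofReal.tendsto _).comp (hmom k)).const_mul _
  have htot := ((tendsto_iff_dist_tendsto_zero.1 hpart).add
    ((hmom (2 * n)).const_mul (|θ| ^ (2 * n) / (2 * n).factorial)))
  rw [zero_add] at htot
  filter_upwards [hbound n, htot.eventually_lt_const hn2] with i hi1 hi2
  rw [← dist_eq_norm] at hi1
  linarith [dist_triangle4 (∫ ω, Complex.exp (Complex.I * θ * (Y i ω : ℂ)) ∂(P i))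
    (∑ k ∈ Finset.range (2 * n),
      (Complex.I * θ) ^ k / (k.factorial : ℂ) * ((∫ ω, Y i ω ^ k ∂(P i) : ℝ) : ℂ))
    (∑ k ∈ Finset.range (2 * n), (Complex.I * θ) ^ k / (k.factorial : ℂ) * (gaussMoment k : ℂ))
    (Complex.exp (-(θ : ℂ) ^ 2 / 2))]

section Cumulants

variable {Ω : Type*} [MeasurableSpace Ω] {μ : Measure Ω} {X : Ω → ℝ} {s : ℝ}

lemma integrableExpSet_sub_const (c : ℝ) :
    integrableExpSet (fun ω => X ω - c) μ = integrableExpSet X μ := by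
  ext u
  simp only [integrableExpSet, Set.mem_ofPred_eq, mul_sub, Real.exp_sub, div_eq_mul_inv]
  exact integrable_mul_const_iff (isUnit_iff_ne_zero.2 (inv_ne_zero (Real.exp_ne_zero _))) _

lemma mgf_sub_const (c u : ℝ) :
    mgf (fun ω => X ω - c) μ u = mgf X μ u * Real.exp (-(u * c)) := by
  simp only [sub_eq_add_neg, mgf_add_const, mul_neg]

/-- The moment-cumulant recursion. -/
lemma iteratedDeriv_succ_mgf (hμ : μ ≠ 0) (hs : s ∈ interior (integrableExpSet X μ)) (k : ℕ) :
    iteratedDeriv (k + 1) (mgf X μ) s = ∑ j ∈ Finset.range (k + 1),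
      (k.choose j : ℝ) * iteratedDeriv (j + 1) (cgf X μ) s * iteratedDeriv (k - j) (mgf X μ) s := by
  have hev : deriv (mgf X μ) =ᶠ[𝓝 s] deriv (cgf X μ) * mgf X μ := by
    filter_upwards [isOpen_interior.eventually_mem hs] with u hu
    rw [Pi.mul_apply, deriv_cgf hu, deriv_mgf hu,
      div_mul_cancel₀ _ (mgf_pos' hμ (interior_subset (s := integrableExpSet X μ) hu)).ne']
  rw [iteratedDeriv_succ', hev.iteratedDeriv_eq,
    iteratedDeriv_mul (analyticAt_cgf hs).deriv.contDiffAt (analyticAt_mgf hs).contDiffAt]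
  simp only [iteratedDeriv_succ']

lemma iteratedDeriv_cgf_sub_const (hμ : μ ≠ 0) (hs : s ∈ interior (integrableExpSet X μ))
    (c : ℝ) (j : ℕ) :
    iteratedDeriv (j + 1) (cgf (fun ω => X ω - c) μ) s =
      if j = 0 then deriv (cgf X μ) s - c else iteratedDeriv (j + 1) (cgf X μ) s := by
  have hev : deriv (cgf (fun ω => X ω - c) μ) =ᶠ[𝓝 s] fun u => deriv (cgf X μ) u - c := by
    have h0 : cgf (fun ω => X ω - c) μ =ᶠ[𝓝 s] fun u => cgf X μ u - u * c := by
      filter_upwards [isOpen_interior.eventually_mem hs] with u hu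
      have hu' := mgf_pos' hμ (interior_subset (s := integrableExpSet X μ) hu)
      rw [cgf, mgf_sub_const, Real.log_mul hu'.ne' (Real.exp_ne_zero _), Real.log_exp, cgf,
        sub_eq_add_neg]
    filter_upwards [h0.eventuallyEq_nhds, isOpen_interior.eventually_mem hs] with u hu hu'
    rw [hu.deriv_eq]
    exact ((analyticAt_cgf hu').differentiableAt.hasDerivAt.sub
      (by simpa using (hasDerivAt_id u).mul_const c)).deriv
  rw [iteratedDeriv_succ', hev.iteratedDeriv_eq]
  cases j with
  | zero => simp
  | succ j =>
    rw [iteratedDeriv_succ', if_neg j.succ_ne_zero, iteratedDeriv_succ', iteratedDeriv_succ']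
    congr 1
    ext u
    exact deriv_sub_const _

lemma integral_pow_tilted_mul (hs : s ∈ interior (integrableExpSet X μ)) (k : ℕ) :
    ∫ ω, X ω ^ k ∂(μ.tilted (fun ω => s * X ω)) = iteratedDeriv k (mgf X μ) s / mgf X μ s := by
  rw [integral_tilted_mul_eq_mgf, iteratedDeriv_mgf hs, ← integral_div]
  congr with ω
  simp only [smul_eq_mul]
  ring

/-- The recursion expressing the central moments of a tilted measure by the cumulants. -/
lemma integral_centered_pow_succ_tilted (hμ : μ ≠ 0) (hs : s ∈ interior (integrableExpSet X μ))
    {Z : Ω → ℝ} (hZ : Z = fun ω => X ω - deriv (cgf X μ) s) (k : ℕ) :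
    ∫ ω, Z ω ^ (k + 1) ∂(μ.tilted (fun ω => s * Z ω)) = ∑ j ∈ Finset.range (k + 1),
      (k.choose j : ℝ) * (if j = 0 then 0 else iteratedDeriv (j + 1) (cgf X μ) s) *
        ∫ ω, Z ω ^ (k - j) ∂(μ.tilted (fun ω => s * Z ω)) := by
  subst hZ
  have hs' : s ∈ interior (integrableExpSet (fun ω => X ω - deriv (cgf X μ) s) μ) := by
    rwa [integrableExpSet_sub_const]
  simp only [integral_pow_tilted_mul hs']
  rw [iteratedDeriv_succ_mgf hμ hs', Finset.sum_div]
  refine Finset.sum_congr rfl fun j _ => ?_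
  rw [iteratedDeriv_cgf_sub_const hμ hs, sub_self, mul_div_assoc]

end Cumulants

/-- The measure on `ℕ` whose point masses are the coefficients. -/
noncomputable def coeffMeasure (a : ℕ → ℝ) : Measure ℕ :=
  Measure.sum fun n => ENNReal.ofReal (a n) • Measure.dirac n

namespace IsK

variable {a : ℕ → ℝ} {R : ℝ}

lemma integral_coeffMeasure (hK : IsK a R) {E : Type*} [NormedAddCommGroup E] [NormedSpace ℝ E]
    [FiniteDimensional ℝ E] (g : ℕ → E) :
    ∫ n, g n ∂(coeffMeasure a) = ∑' n, a n • g n := by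
  simp [coeffMeasure, integral_sum_dirac, ENNReal.toReal_ofReal (hK.nonneg _)]

lemma coeffMeasure_singleton (n : ℕ) : coeffMeasure a {n} = ENNReal.ofReal (a n) :=
  Measure.sum_smul_dirac_singleton

lemma coeffMeasure_ne_zero (hK : IsK a R) : coeffMeasure a ≠ 0 := by
  intro h
  have := coeffMeasure_singleton (a := a) 0
  rw [h, eq_comm] at this
  exact hK.pos₀.not_ge (ENNReal.ofReal_eq_zero.1 (by simpa using this))

lemma mgf_coeffMeasure (hK : IsK a R) (s : ℝ) :
    mgf (fun n : ℕ => (n : ℝ)) (coeffMeasure a) s = fsum a (Real.exp s) := by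
  simp only [mgf, hK.integral_coeffMeasure, fsum, smul_eq_mul, ← Real.exp_nat_mul, mul_comm s]

lemma cgf_coeffMeasure (hK : IsK a R) :
    cgf (fun n : ℕ => (n : ℝ)) (coeffMeasure a) = fulcrum a := by
  ext s
  rw [cgf, hK.mgf_coeffMeasure, fulcrum]

lemma mem_interior_integrableExpSet (hK : IsK a R) {s : ℝ} (hs : s < Real.log R) :
    s ∈ interior (integrableExpSet (fun n : ℕ => (n : ℝ)) (coeffMeasure a)) := by
  refine interior_maximal (fun u hu => ?_) isOpen_Iio (Set.mem_Iio.2 hs)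
  have h := hK.conv (Real.exp u) (Real.exp_pos u).le ((Real.lt_log_iff_exp_lt hK.Rpos).1 hu)
  rw [integrableExpSet, Set.mem_ofPred_eq, coeffMeasure,
    integrable_sum_dirac_iff fun _ => ENNReal.ofReal_ne_top]
  refine h.congr fun n => ?_
  rw [ENNReal.toReal_ofReal (hK.nonneg n), Real.norm_of_nonneg (Real.exp_pos _).le,
    ← Real.exp_nat_mul, mul_comm u]

lemma deriv_fulcrum (hK : IsK a R) {s : ℝ} (hs : s < Real.log R) :
    deriv (fulcrum a) s = mf a (Real.exp s) := by
  rw [← hK.cgf_coeffMeasure, deriv_cgf (hK.mem_interior_integrableExpSet hs),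
    hK.mgf_coeffMeasure, hK.integral_coeffMeasure, mf]
  congr 1
  refine tsum_congr fun n => ?_
  rw [← Real.exp_nat_mul, mul_comm s, smul_eq_mul]
  ring

lemma iteratedDeriv_two_fulcrum (hK : IsK a R) {s : ℝ} (hs : s < Real.log R) :
    iteratedDeriv 2 (fulcrum a) s = sigma2 a (Real.exp s) := by
  rw [← hK.cgf_coeffMeasure, iteratedDeriv_two_cgf (hK.mem_interior_integrableExpSet hs),
    hK.mgf_coeffMeasure, hK.integral_coeffMeasure, sigma2, hK.cgf_coeffMeasure,
    hK.deriv_fulcrum hs]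
  congr 2
  refine tsum_congr fun n => ?_
  rw [← Real.exp_nat_mul, mul_comm s, smul_eq_mul]
  ring

lemma iteratedDeriv_two_fulcrum_pos (hK : IsK a R) {s : ℝ} (hs : s < Real.log R) :
    0 < iteratedDeriv 2 (fulcrum a) s := by
  have hmem := hK.mem_interior_integrableExpSet hs
  have hmgf := mgf_pos' hK.coeffMeasure_ne_zero
    (interior_subset (s := integrableExpSet _ _) hmem)
  rw [← hK.cgf_coeffMeasure, iteratedDeriv_two_cgf_eq_integral hmem]
  set d := deriv (cgf (fun n : ℕ => (n : ℝ)) (coeffMeasure a)) s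
  refine div_pos ?_ hmgf
  have hint : Integrable (fun n : ℕ => ((n : ℝ) - d) ^ 2 * Real.exp (s * n)) (coeffMeasure a) := by
    have hmem' := hmem
    rw [← integrableExpSet_sub_const d] at hmem'
    refine ((integrable_pow_mul_exp_of_mem_interior_integrableExpSet hmem' 2).mul_const
      (Real.exp (s * d))).congr (Eventually.of_forall fun n => ?_)
    simp only
    rw [mul_assoc, ← Real.exp_add]
    ring_nf
  rw [integral_pos_iff_support_of_nonneg (fun n => by positivity) hint]
  obtain ⟨n, hn, han⟩ := hK.nonconst
  obtain ⟨m, hm, ham⟩ : ∃ m : ℕ, (m : ℝ) ≠ d ∧ 0 < a m := by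
    by_cases h0 : d = 0
    · exact ⟨n, by rw [h0]; exact_mod_cast hn.ne', han⟩
    · exact ⟨0, by simpa using Ne.symm h0, hK.pos₀⟩
  refine lt_of_lt_of_le ?_ (measure_mono (Set.singleton_subset_iff.2 (?_ : m ∈ _)))
  · rw [coeffMeasure_singleton]
    exact ENNReal.ofReal_pos.2 ham
  · exact mul_ne_zero (pow_ne_zero 2 (sub_ne_zero.2 hm)) (Real.exp_ne_zero _)

lemma Fq_eq (hK : IsK a R) {s : ℝ} (hs : s < Real.log R) (j : ℕ) :
    Fq a j s = iteratedDeriv j (fulcrum a) s / sigma a (Real.exp s) ^ j := by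
  have h := (hK.iteratedDeriv_two_fulcrum_pos hs).le
  rw [Fq, sigma, ← hK.iteratedDeriv_two_fulcrum hs, Real.sqrt_eq_rpow, ← Real.rpow_mul_natCast h,
    one_div_mul_eq_div]

lemma sigma_pos (hK : IsK a R) {s : ℝ} (hs : s < Real.log R) : 0 < sigma a (Real.exp s) := by
  rw [sigma, ← hK.iteratedDeriv_two_fulcrum hs]
  exact Real.sqrt_pos.2 (hK.iteratedDeriv_two_fulcrum_pos hs)

lemma Fq_two (hK : IsK a R) {s : ℝ} (hs : s < Real.log R) : Fq a 2 s = 1 := by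
  rw [Fq]
  norm_num
  exact (hK.iteratedDeriv_two_fulcrum_pos hs).ne'

end IsK

/-- The law of `X_t` for `t = exp s`. -/
noncomputable def khinchinLaw (a : ℕ → ℝ) (s : ℝ) : Measure ℕ :=
  (coeffMeasure a).tilted fun n : ℕ => s * ((n : ℝ) - mf a (Real.exp s))

/-- The normalized variable `X̆_t` for `t = exp s`. -/
noncomputable def normVar (a : ℕ → ℝ) (s : ℝ) (n : ℕ) : ℝ :=
  ((n : ℝ) - mf a (Real.exp s)) / sigma a (Real.exp s)

namespace IsK

variable {a : ℕ → ℝ} {R s : ℝ}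

lemma mem_interior_integrableExpSet_sub (hK : IsK a R) (hs : s < Real.log R) (c : ℝ) :
    s ∈ interior (integrableExpSet (fun n : ℕ => (n : ℝ) - c) (coeffMeasure a)) := by
  rw [integrableExpSet_sub_const]
  exact hK.mem_interior_integrableExpSet hs

lemma integrable_normVar_pow (hK : IsK a R) (hs : s < Real.log R) (k : ℕ) :
    Integrable (fun n => normVar a s n ^ k) (khinchinLaw a s) := by
  have hmem := hK.mem_interior_integrableExpSet_sub hs (mf a (Real.exp s))
  have h := integrable_pow_mul_exp_of_mem_interior_integrableExpSet hmem k
  rw [khinchinLaw, integrable_tilted_iff (interior_subset (s := integrableExpSet _ _) hmem)]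
  refine (h.div_const (sigma a (Real.exp s) ^ k)).congr (Eventually.of_forall fun n => ?_)
  simp only [normVar, smul_eq_mul, div_pow]
  ring

lemma integral_normVar_pow_zero (hK : IsK a R) (hs : s < Real.log R) :
    ∫ n, normVar a s n ^ 0 ∂(khinchinLaw a s) = 1 := by
  have : NeZero (coeffMeasure a) := ⟨hK.coeffMeasure_ne_zero⟩
  have : IsProbabilityMeasure (khinchinLaw a s) := isProbabilityMeasure_tilted
    (interior_subset (s := integrableExpSet _ _)
      (hK.mem_interior_integrableExpSet_sub hs (mf a (Real.exp s))))
  simp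

lemma integral_normVar_pow_succ (hK : IsK a R) (hs : s < Real.log R) (k : ℕ) :
    ∫ n, normVar a s n ^ (k + 1) ∂(khinchinLaw a s) = ∑ j ∈ Finset.range (k + 1),
      (k.choose j : ℝ) * (if j = 0 then 0 else Fq a (j + 1) s) *
        ∫ n, normVar a s n ^ (k - j) ∂(khinchinLaw a s) := by
  have hmem := hK.mem_interior_integrableExpSet hs
  have h := integral_centered_pow_succ_tilted hK.coeffMeasure_ne_zero hmem
    (Z := fun n : ℕ => (n : ℝ) - mf a (Real.exp s))
    (by rw [hK.cgf_coeffMeasure, hK.deriv_fulcrum hs]) k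
  have hσ := (hK.sigma_pos hs).ne'
  simp only [normVar, div_pow, integral_div, khinchinLaw]
  rw [h, Finset.sum_div, hK.cgf_coeffMeasure]
  refine Finset.sum_congr rfl fun j hj => ?_
  have hjk : k + 1 = (j + 1) + (k - j) := by
    have := Finset.mem_range.1 hj
    omega
  rw [hK.Fq_eq hs]
  split_ifs
  · simp
  · rw [hjk, pow_add]
    field_simp

lemma tendsto_integral_normVar_pow (hK : IsK a R)
    (h : ∀ k : ℕ, 3 ≤ k → Tendsto (fun s => Fq a k s) (𝓝[<] Real.log R) (𝓝 0)) (k : ℕ) :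
    Tendsto (fun s => ∫ n, normVar a s n ^ k ∂(khinchinLaw a s)) (𝓝[<] Real.log R)
      (𝓝 (gaussMoment k)) := by
  have hlt : ∀ᶠ s in 𝓝[<] Real.log R, s < Real.log R := self_mem_nhdsWithin
  have hcum : ∀ j : ℕ, Tendsto (fun s => if j = 0 then 0 else Fq a (j + 1) s)
      (𝓝[<] Real.log R) (𝓝 (if j = 1 then 1 else 0)) := by
    rintro (_ | _ | j)
    · simp
    · refine tendsto_const_nhds.congr' ?_
      filter_upwards [hlt] with s hs
      simp [hK.Fq_two hs]
    · simpa using h (j + 1 + 1 + 1) (by omega)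
  induction k using Nat.strong_induction_on with
  | _ k ih =>
    cases k with
    | zero =>
      have h0 : gaussMoment 0 = 1 := by simp [gaussMoment]
      rw [h0]
      refine tendsto_const_nhds.congr' ?_
      filter_upwards [hlt] with s hs
      rw [hK.integral_normVar_pow_zero hs]
    | succ k =>
      have hlim := tendsto_finsetSum (Finset.range (k + 1)) fun j _ =>
        ((hcum j).const_mul (k.choose j : ℝ)).mul (ih (k - j) (by omega))
      have hval : ∑ j ∈ Finset.range (k + 1),
          (k.choose j : ℝ) * (if j = 1 then 1 else 0) * gaussMoment (k - j)
            = gaussMoment (k + 1) := by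
        cases k with
        | zero => simp [gaussMoment]
        | succ k =>
          rw [Finset.sum_eq_single_of_mem 1 (by simp) fun j _ hj => by simp [hj],
            gaussMoment_add_two]
          simp
      rw [hval] at hlim
      refine hlim.congr' ?_
      filter_upwards [hlt] with s hs
      rw [hK.integral_normVar_pow_succ hs]

lemma charfun_exp (hK : IsK a R) (s θ : ℝ) :
    charfun a (Real.exp s) θ =
      ∫ n, Complex.exp (Complex.I * θ * (normVar a s n : ℂ)) ∂(khinchinLaw a s) := by
  rw [khinchinLaw, integral_tilted_mul_eq_mgf, hK.integral_coeffMeasure, charfun]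
  refine tsum_congr fun n => ?_
  rw [mgf_sub_const, hK.mgf_coeffMeasure, smul_smul, Complex.real_smul, normVar, mul_sub s,
    sub_eq_add_neg (s * _), Real.exp_add, mul_div_mul_right _ _ (Real.exp_ne_zero _), ← Real.exp_nat_mul,
    mul_comm s, mul_div_assoc]

end IsK

/-- if `F^{(k)}(s)/F''(s)^{k/2} → 0` as `s ↑ ln R` for every `k ≥ 3`,
then `f` is Gaussian. -/
theorem statement6 (a : ℕ → ℝ) (R : ℝ) (hK : IsK a R)
    (h : ∀ k : ℕ, 3 ≤ k → Tendsto (fun s => Fq a k s) (𝓝[<] Real.log R) (𝓝 0)) :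
    IsGaussian a R := by

  intro θ
  have hexp : Tendsto (fun s => charfun a (Real.exp s) θ) (𝓝[<] Real.log R)
      (𝓝 (Complex.exp (-(θ : ℂ) ^ 2 / 2))) := by
    simp only [hK.charfun_exp]
    refine tendsto_integral_exp_of_tendsto_moments ?_ (hK.tendsto_integral_normVar_pow h) θ
    filter_upwards [self_mem_nhdsWithin] with s hs
    exact hK.integrable_normVar_pow hs
  have hpos : ∀ᶠ t in 𝓝[<] R, 0 < t := nhdsWithin_le_nhds (lt_mem_nhds hK.Rpos)
  have hlog : Tendsto Real.log (𝓝[<] R) (𝓝[<] Real.log R) := by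
    refine tendsto_nhdsWithin_iff.2
      ⟨(Real.continuousAt_log hK.Rpos.ne').tendsto.mono_left nhdsWithin_le_nhds, ?_⟩
    filter_upwards [hpos, self_mem_nhdsWithin] with t ht htR
    exact Real.log_lt_log ht htR
  refine (hexp.comp hlog).congr' ?_
  filter_upwards [hpos] with t ht
  simp only [Function.comp_apply, Real.exp_log ht]

end KhinchinPaper
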